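/- Let φ₀(ξ) = tanh(ξ/√2), let κ ∈ ℝ, and let φ₁ : ℝ → ℝ be twice continuously differentiable with φ₁, φ₁' and φ₁'' bounded on ℝ. Suppose that for all ξ ∈ ℝ: κ·φ₀'(ξ) + φ₁''(ξ) − (3φ₀(ξ)² − 1)·φ₁(ξ) = 0. Then κ = 0. -/

import Mathlib

open Filter Topology

theorem Real.hasDerivAt_tanh_one_sub_sq (x : ℝ) :
    HasDerivAt Real.tanh (1 - Real.tanh x ^ 2) x := by
  have hc : Real.cosh x ≠ 0 := (Real.cosh_pos x).ne'
  have h := (Real.hasDerivAt_sinh x).div (Real.hasDerivAt_cosh x) hc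
  have hf : Real.tanh = Real.sinh / Real.cosh := by
    funext y
    simp [Real.tanh_eq_sinh_div_cosh]
  rw [hf]
  refine h.congr_deriv ?_
  rw [Pi.div_apply]
  field_simp

theorem Real.tendsto_tanh_atTop_one : Tendsto Real.tanh atTop (𝓝 1) := by
  have h : ∀ x : ℝ, Real.tanh x = 1 - 2 * (Real.exp (2 * x) + 1)⁻¹ := by
    intro x
    have hx : Real.exp (2 * x) = Real.exp x * Real.exp x := by rw [← Real.exp_add]; ring_nf
    rw [Real.tanh_eq_sinh_div_cosh, Real.sinh_eq, Real.cosh_eq, hx, Real.exp_neg]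
    have := Real.exp_pos x
    field_simp
    ring
  have hexp : Tendsto (fun x : ℝ => Real.exp (2 * x) + 1) atTop atTop :=
    tendsto_atTop_add_const_right _ _
      (Real.tendsto_exp_atTop.comp (tendsto_id.const_mul_atTop two_pos))
  have h' := (hexp.inv_tendsto_atTop.const_mul 2).const_sub 1
  simp only [mul_zero, sub_zero] at h'
  exact h'.congr fun x => (h x).symm


/-- Curvature condition on `Γ∖S` in the case (C2) `M_ε = 1/ε`: if the corrector
equation `κφ₀' + φ₁'' − (3φ₀² − 1)φ₁ = 0` is solvable with bounded `φ₁`,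
then the mean curvature `κ` vanishes. -/
theorem curvature_vanishes
    (φ₀ : ℝ → ℝ) (hφ₀ : ∀ ξ : ℝ, φ₀ ξ = Real.tanh (ξ / Real.sqrt 2))
    (κ : ℝ)
    (φ₁ : ℝ → ℝ) (hφ₁ : ContDiff ℝ 2 φ₁)
    (hb : ∃ C : ℝ, ∀ ξ : ℝ, |φ₁ ξ| ≤ C)
    (hb' : ∃ C : ℝ, ∀ ξ : ℝ, |deriv φ₁ ξ| ≤ C)
    (hb'' : ∃ C : ℝ, ∀ ξ : ℝ, |deriv (deriv φ₁) ξ| ≤ C)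
    (heq : ∀ ξ : ℝ, κ * deriv φ₀ ξ + deriv (deriv φ₁) ξ
      - (3 * φ₀ ξ ^ 2 - 1) * φ₁ ξ = 0) :
    κ = 0 := by
  obtain ⟨C, hC⟩ := hb
  obtain ⟨C', hC'⟩ := hb'
  set r := Real.sqrt 2 with hr
  have hr2 : r ^ 2 = 2 := Real.sq_sqrt (by norm_num)
  have hr0 : 0 < r := Real.sqrt_pos.mpr (by norm_num)
  have hri : r⁻¹ ^ 2 = 1 / 2 := by rw [inv_pow, hr2]; norm_num
  have ht : ∀ x, HasDerivAt φ₀ ((1 - φ₀ x ^ 2) * r⁻¹) x := by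
    intro x
    have h := (Real.hasDerivAt_tanh_one_sub_sq (x / r)).comp x ((hasDerivAt_id x).div_const r)
    rw [show φ₀ = Real.tanh ∘ fun y => id y / r from funext hφ₀]
    simpa [one_div] using h
  have hd : ∀ x, HasDerivAt φ₁ (deriv φ₁ x) x := fun x =>
    (hφ₁.differentiable (by norm_num) x).hasDerivAt
  have hdd : ∀ x, HasDerivAt (deriv φ₁) (deriv (deriv φ₁) x) x := fun x =>
    ((ContDiff.differentiable_deriv_two hφ₁) x).hasDerivAt
  -- The primitive of the equation tested against `φ₀'`.
  let G : ℝ → ℝ := fun x => κ * ((φ₀ x - φ₀ x ^ 3 / 3) * r⁻¹)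
    + (1 - φ₀ x ^ 2) * (r⁻¹ * deriv φ₁ x + φ₀ x * φ₁ x)
  have hG : ∀ x, HasDerivAt G 0 x := by
    intro x
    have h := ((((ht x).sub (((ht x).pow 3).div_const 3)).mul_const r⁻¹).const_mul κ).add
      ((((ht x).pow 2).const_sub 1).mul (((hdd x).const_mul r⁻¹).add ((ht x).mul (hd x))))
    refine h.congr_deriv ?_
    have e := heq x
    rw [(ht x).deriv] at e
    simp only [Pi.add_apply, Pi.mul_apply, Pi.pow_apply]
    push_cast
    have e' : deriv (deriv φ₁) x =
        (3 * φ₀ x ^ 2 - 1) * φ₁ x - κ * ((1 - φ₀ x ^ 2) * r⁻¹) := by linarith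
    rw [e']
    linear_combination (-2 * φ₀ x * deriv φ₁ x * (1 - φ₀ x ^ 2)) * hri
  have hconst : ∀ x, G x = G (-x) := fun x =>
    is_const_of_deriv_eq_zero (fun y => (hG y).differentiableAt) (fun y => (hG y).deriv) _ _
  have hodd : ∀ x, φ₀ (-x) = -φ₀ x := fun x => by
    rw [hφ₀, hφ₀, neg_div, Real.tanh_neg]
  have hlim : Tendsto φ₀ atTop (𝓝 1) := by
    have h := Real.tendsto_tanh_atTop_one.comp (tendsto_id.atTop_div_const hr0)
    exact h.congr fun x => (hφ₀ x).symm
  have hsq : ∀ x, φ₀ x ^ 2 ≤ 1 := fun x => by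
    rw [hφ₀]; exact (Real.tanh_sq_lt_one _).le
  have hbound : ∀ x, |r⁻¹ * deriv φ₁ x + φ₀ x * φ₁ x| ≤ r⁻¹ * C' + C := by
    intro x
    refine (abs_add_le _ _).trans ?_
    rw [abs_mul, abs_mul, abs_of_pos (inv_pos.mpr hr0)]
    have h1 : |φ₀ x| ≤ 1 := abs_le_one_iff_mul_self_le_one.mpr (by nlinarith [hsq x])
    have h2 : |φ₀ x| * |φ₁ x| ≤ |φ₁ x| := mul_le_of_le_one_left (abs_nonneg _) h1
    have h3 := mul_le_mul_of_nonneg_left (hC' x) (inv_pos.mpr hr0).le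
    linarith [hC x]
  have hle : ∀ x, |κ * (2 * (φ₀ x - φ₀ x ^ 3 / 3) * r⁻¹)|
      ≤ (1 - φ₀ x ^ 2) * (2 * (r⁻¹ * C' + C)) := by
    intro x
    have h := hconst x
    simp only [G, hodd] at h
    have hp : 0 ≤ 1 - φ₀ x ^ 2 := by linarith [hsq x]
    have b1 := hbound x
    have b2 := hbound (-x)
    rw [hodd] at b2
    have e : κ * (2 * (φ₀ x - φ₀ x ^ 3 / 3) * r⁻¹) = (1 - φ₀ x ^ 2) *
        ((r⁻¹ * deriv φ₁ (-x) + -φ₀ x * φ₁ (-x)) - (r⁻¹ * deriv φ₁ x + φ₀ x * φ₁ x)) := by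
      linear_combination h
    rw [e, abs_mul, abs_of_nonneg hp]
    refine mul_le_mul_of_nonneg_left ((abs_sub _ _).trans ?_) hp
    linarith
  have hL : Tendsto (fun x => |κ * (2 * (φ₀ x - φ₀ x ^ 3 / 3) * r⁻¹)|) atTop
      (𝓝 |κ * (2 * (1 - 1 ^ 3 / 3) * r⁻¹)|) :=
    ((((hlim.sub ((hlim.pow 3).div_const 3)).const_mul 2).mul_const r⁻¹).const_mul κ).abs
  have hR : Tendsto (fun x => (1 - φ₀ x ^ 2) * (2 * (r⁻¹ * C' + C))) atTop
      (𝓝 ((1 - 1 ^ 2) * (2 * (r⁻¹ * C' + C)))) :=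
    ((hlim.pow 2).const_sub 1).mul_const _
  have hfin := le_of_tendsto_of_tendsto' hL hR hle
  simp only [one_pow, sub_self, zero_mul] at hfin
  have hz := abs_nonpos_iff.mp hfin
  refine (mul_eq_zero.mp hz).resolve_right ?_
  exact mul_ne_zero (by norm_num) (inv_pos.mpr hr0).ne'
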